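/- Let M = ⟨W, v⁺, v⁻, μ, e₁, e₂⟩ be a Pr_Ł²Δ model in which μ is a classical (finitely additive) probability measure on W. Define M* = ⟨W, (v*)⁺, (v*)⁻, μ, e*₁, e*₂⟩ where (v*)⁺(p) = W∖v⁻(p) and (v*)⁻(p) = W∖v⁺(p). Then μ is a ±-probability on the BD model ⟨W,(v*)⁺,(v*)⁻⟩ (so M* is a Pr_Ł²Δ model), and for every formula α ∈ L_PrŁ²Δ: e*₁(α) = 1 − e₂(α) and e*₂(α) = 1 − e₁(α). -/

import Mathlib

inductive BD : Type where
  | var : ℕ → BD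
  | neg : BD → BD
  | and : BD → BD → BD
  | or  : BD → BD → BD

structure BDModel (W : Type) where
  vpos : ℕ → Set W
  vneg : ℕ → Set W

mutual
  def suppT {W : Type} (M : BDModel W) : BD → W → Prop
    | .var p, w => w ∈ M.vpos p
    | .neg φ, w => suppF M φ w
    | .and φ χ, w => suppT M φ w ∧ suppT M χ w
    | .or φ χ, w => suppT M φ w ∨ suppT M χ w
  def suppF {W : Type} (M : BDModel W) : BD → W → Prop
    | .var p, w => w ∈ M.vneg p
    | .neg φ, w => suppT M φ w
    | .and φ χ, w => suppF M φ w ∨ suppF M χ w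
    | .or φ χ, w => suppF M φ w ∧ suppF M χ w
end

def extP {W : Type} (M : BDModel W) (φ : BD) : Set W := {w | suppT M φ w}
def extN {W : Type} (M : BDModel W) (φ : BD) : Set W := {w | suppF M φ w}

/-- A BD model (on a nonempty carrier) together with a ±-probability. -/
structure PrModel (W : Type) [Nonempty W] where
  M : BDModel W
  mu : Set W → ℝ
  mu_mem : ∀ X : Set W, mu X ∈ Set.Icc (0:ℝ) 1
  mon : ∀ X Y : Set W, X ⊆ Y → mu X ≤ mu Y
  negp : ∀ φ : BD, mu (extN M φ) = mu (extP M (.neg φ))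
  ex : ∀ φ χ : BD,
    mu (extP M (.or φ χ)) = mu (extP M φ) + mu (extP M χ) - mu (extP M (.and φ χ))

/-- The language L_PrŁ²Δ: α ::= Pr φ | ¬α | ∼α | Δα | (α→α). -/
inductive PrF : Type where
  | pr : BD → PrF
  | neg : PrF → PrF
  | snot : PrF → PrF
  | delta : PrF → PrF
  | imp : PrF → PrF → PrF

open Classical in
mutual
  /-- Support of truth e₁ in a Pr_Ł²Δ model. -/
  noncomputable def pe1 {W : Type} [Nonempty W] (P : PrModel W) : PrF → ℝ
    | .pr φ => P.mu (extP P.M φ)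
    | .neg α => pe2 P α
    | .snot α => 1 - pe1 P α
    | .delta α => if pe1 P α = 1 then 1 else 0
    | .imp α β => min 1 (1 - pe1 P α + pe1 P β)
  /-- Support of falsity e₂ in a Pr_Ł²Δ model. -/
  noncomputable def pe2 {W : Type} [Nonempty W] (P : PrModel W) : PrF → ℝ
    | .pr φ => P.mu (extN P.M φ)
    | .neg α => pe1 P α
    | .snot α => 1 - pe2 P α
    | .delta α => if pe2 P α = 0 then 0 else 1
    | .imp α β => max 0 (pe2 P β - pe2 P α)
end

/-- Pr_Ł²Δ validity: value (1,0) in every model. -/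
def PrValid (α : PrF) : Prop :=
  ∀ (W : Type) (_ : Nonempty W) (P : PrModel W), pe1 P α = 1 ∧ pe2 P α = 0

/-- The ¬-normal form transformation pushing ¬ to modal atoms. -/
def PrF.nnf : PrF → PrF
  | .pr φ => .pr φ
  | .snot α => .snot α.nnf
  | .delta α => .delta α.nnf
  | .imp α β => .imp α.nnf β.nnf
  | .neg (.pr φ) => .pr (.neg φ)
  | .neg (.neg α) => α.nnf
  | .neg (.snot α) => .snot (PrF.nnf (.neg α))
  | .neg (.imp α β) => .snot (.imp (PrF.nnf (.neg β)) (PrF.nnf (.neg α)))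
  | .neg (.delta α) => .snot (.delta (.snot (PrF.nnf (.neg α))))

/-- The "conflation" model M*. -/
def starModel {W : Type} (M : BDModel W) : BDModel W where
  vpos := fun p => (M.vneg p)ᶜ
  vneg := fun p => (M.vpos p)ᶜ

/-- A classical (finitely additive, normalized) probability measure on W. -/
def IsClassicalMeasure {W : Type} (mu : Set W → ℝ) : Prop :=
  (∀ X : Set W, mu X ∈ Set.Icc (0:ℝ) 1) ∧ mu Set.univ = 1 ∧
    ∀ X Y : Set W, Disjoint X Y → mu (X ∪ Y) = mu X + mu Y

theorem suppT_suppF_starModel {W : Type} (M : BDModel W) (φ : BD) (w : W) :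
    (suppT (starModel M) φ w ↔ ¬ suppF M φ w) ∧ (suppF (starModel M) φ w ↔ ¬ suppT M φ w) := by
  induction φ with
  | var p => simp [suppT, suppF, starModel]
  | neg φ ih => simpa only [suppT, suppF] using ih.symm
  | and φ χ ihφ ihχ => simp only [suppT, suppF]; tauto
  | or φ χ ihφ ihχ => simp only [suppT, suppF]; tauto

theorem extP_starModel {W : Type} (M : BDModel W) (φ : BD) :
    extP (starModel M) φ = (extN M φ)ᶜ :=
  Set.ext fun w => (suppT_suppF_starModel M φ w).1

theorem extN_starModel {W : Type} (M : BDModel W) (φ : BD) :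
    extN (starModel M) φ = (extP M φ)ᶜ :=
  Set.ext fun w => (suppT_suppF_starModel M φ w).2

theorem extN_eq_extP_neg {W : Type} (M : BDModel W) (φ : BD) : extN M φ = extP M (.neg φ) :=
  Set.ext fun w => by simp only [extN, extP, Set.mem_ofPred_eq, suppT]

theorem extP_and {W : Type} (M : BDModel W) (φ χ : BD) :
    extP M (.and φ χ) = extP M φ ∩ extP M χ :=
  Set.ext fun w => by simp only [extP, Set.mem_inter_iff, Set.mem_ofPred_eq, suppT]

theorem extP_or {W : Type} (M : BDModel W) (φ χ : BD) :
    extP M (.or φ χ) = extP M φ ∪ extP M χ :=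
  Set.ext fun w => by simp only [extP, Set.mem_union, Set.mem_ofPred_eq, suppT]

namespace IsClassicalMeasure

variable {W : Type} {mu : Set W → ℝ}

theorem compl (h : IsClassicalMeasure mu) (X : Set W) : mu Xᶜ = 1 - mu X := by
  have hX := h.2.2 X Xᶜ disjoint_compl_right
  rw [Set.union_compl_self, h.2.1] at hX
  linarith

theorem mono (h : IsClassicalMeasure mu) {X Y : Set W} (hXY : X ⊆ Y) : mu X ≤ mu Y := by
  have hY := h.2.2 X (Y \ X) Set.disjoint_sdiff_right
  rw [Set.union_sdiff_cancel hXY] at hY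
  linarith [(h.1 (Y \ X)).1]

theorem union (h : IsClassicalMeasure mu) (X Y : Set W) :
    mu (X ∪ Y) = mu X + mu Y - mu (X ∩ Y) := by
  have hXY := h.2.2 X (Y \ X) Set.disjoint_sdiff_right
  have hY := h.2.2 (X ∩ Y) (Y \ X) (Set.disjoint_sdiff_right.mono_left Set.inter_subset_left)
  rw [Set.union_sdiff_self] at hXY
  rw [Set.inter_comm, Set.inter_union_sdiff] at hY
  rw [Set.inter_comm]
  linarith

/-- A classical measure is a ±-probability on every BD model. -/
def toPrModel [Nonempty W] (h : IsClassicalMeasure mu) (M : BDModel W) : PrModel W where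
  M := M
  mu := mu
  mu_mem := h.1
  mon _ _ := h.mono
  negp φ := by rw [extN_eq_extP_neg]
  ex φ χ := by rw [extP_or, extP_and, h.union]

end IsClassicalMeasure

/-- If μ is classical, then μ is a ±-probability on the conflated BD model M*
(so M* with μ is again a Pr_Ł²Δ model Q), and the values in Q are conflated:
e*₁(α) = 1 − e₂(α) and e*₂(α) = 1 − e₁(α). -/
theorem star_model_conflates {W : Type} [Nonempty W] (P : PrModel W)
    (hcl : IsClassicalMeasure P.mu) :
    ∃ Q : PrModel W, Q.M = starModel P.M ∧ Q.mu = P.mu ∧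
      ∀ α : PrF, pe1 Q α = 1 - pe2 P α ∧ pe2 Q α = 1 - pe1 P α := by
  refine ⟨hcl.toPrModel (starModel P.M), rfl, rfl, fun α => ?_⟩
  induction α with
  | pr φ =>
    simp only [pe1, pe2, IsClassicalMeasure.toPrModel, extP_starModel, extN_starModel, hcl.compl,
      and_self]
  | neg α ih => simpa only [pe1, pe2] using ih.symm
  | snot α ih => simp only [pe1, pe2, ih.1, ih.2, and_self]
  | delta α ih =>
    simp only [pe1, pe2, ih.1, ih.2, sub_eq_self, sub_eq_zero, eq_comm (a := (1 : ℝ))]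
    constructor <;> split_ifs <;> norm_num
  | imp α β ihα ihβ =>
    simp only [pe1, pe2, ihα.1, ihα.2, ihβ.1, ihβ.2]
    constructor
    · rw [← min_sub_sub_left]
      congr 1 <;> ring
    · rw [← max_sub_sub_left]
      congr 1 <;> ring
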